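/- Square-summability of PAO iterate gaps: let λ, μ > 0 and let (A_t, X_t)_{t≥0} be any sequence in 𝒜 × 𝒮 such that for every t, A_{t+1} minimizes A ↦ L(A, X_t) + (λ/2)‖A − A_t‖_F² over 𝒜 and X_{t+1} minimizes X ↦ L(A_{t+1}, X) + (μ/2)‖X − X_t‖_F² over 𝒮. Then Σ_{t=0}^{∞} [(λ/2)‖A_{t+1} − A_t‖_F² + (μ/2)‖X_{t+1} − X_t‖_F²] ≤ L(A_0, X_0); in particular ‖A_{t+1} − A_t‖_F → 0 and ‖X_{t+1} − X_t‖_F → 0 as t → ∞. -/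

import Mathlib

open scoped BigOperators

/-- Frobenius norm of a real matrix. -/
noncomputable def frob {m n : ℕ} (M : Matrix (Fin m) (Fin n) ℝ) : ℝ :=
  Real.sqrt (∑ i, ∑ j, (M i j) ^ 2)

/-- Mixed ℓ_{2,1} norm: sum over rows of the Euclidean norms of the rows. -/
noncomputable def l21 {q n : ℕ} (X : Matrix (Fin q) (Fin n) ℝ) : ℝ :=
  ∑ i, Real.sqrt (∑ j, (X i j) ^ 2)

/-- The R-CoNMF objective L(A, X) = (1/2)‖Y − A·X‖_F² + α‖X‖_{2,1} + (β/2)‖A − P‖_F². -/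
noncomputable def Lobj {d q n : ℕ} (Y : Matrix (Fin d) (Fin n) ℝ)
    (P : Matrix (Fin d) (Fin q) ℝ) (α β : ℝ)
    (A : Matrix (Fin d) (Fin q) ℝ) (X : Matrix (Fin q) (Fin n) ℝ) : ℝ :=
  (1 / 2) * (frob (Y - A * X)) ^ 2 + α * l21 X + (β / 2) * (frob (A - P)) ^ 2

/-- The set 𝒮 of entrywise-nonnegative matrices whose columns each sum to 1. -/
def simplexSet (q n : ℕ) : Set (Matrix (Fin q) (Fin n) ℝ) :=
  {X | (∀ i j, 0 ≤ X i j) ∧ ∀ j, ∑ i, X i j = 1}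

open Filter Topology

theorem frob_nonneg {m n : ℕ} (M : Matrix (Fin m) (Fin n) ℝ) : 0 ≤ frob M :=
  Real.sqrt_nonneg _

@[simp]
theorem frob_zero {m n : ℕ} : frob (0 : Matrix (Fin m) (Fin n) ℝ) = 0 := by
  simp [frob]

theorem l21_nonneg {q n : ℕ} (X : Matrix (Fin q) (Fin n) ℝ) : 0 ≤ l21 X :=
  Finset.sum_nonneg fun _ _ => Real.sqrt_nonneg _

theorem Lobj_nonneg {d q n : ℕ} (Y : Matrix (Fin d) (Fin n) ℝ)
    (P : Matrix (Fin d) (Fin q) ℝ) {α β : ℝ} (hα : 0 ≤ α) (hβ : 0 ≤ β)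
    (A : Matrix (Fin d) (Fin q) ℝ) (X : Matrix (Fin q) (Fin n) ℝ) :
    0 ≤ Lobj Y P α β A X := by
  have := l21_nonneg X
  unfold Lobj
  positivity

/-- If a nonnegative sequence decreases by at least `g t` at step `t`, then the partial sums of `g`
are bounded by its initial value. -/
theorem sum_range_le_of_sufficient_decrease {F g : ℕ → ℝ} (hF : ∀ t, 0 ≤ F t)
    (h : ∀ t, F (t + 1) + g t ≤ F t) (N : ℕ) : ∑ t ∈ Finset.range N, g t ≤ F 0 := by
  have key : ∑ t ∈ Finset.range N, g t ≤ ∑ t ∈ Finset.range N, (F t - F (t + 1)) :=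
    Finset.sum_le_sum fun t _ => by linarith [h t]
  rw [Finset.sum_range_sub'] at key
  linarith [hF N]

/-- A nonnegative sequence tends to zero if a positive multiple of its square is bounded by a
sequence tending to zero. -/
theorem tendsto_zero_of_mul_sq_le {f g : ℕ → ℝ} {c : ℝ} (hc : 0 < c) (hf : ∀ t, 0 ≤ f t)
    (hg : Tendsto g atTop (𝓝 0)) (h : ∀ t, c * f t ^ 2 ≤ g t) : Tendsto f atTop (𝓝 0) := by
  have hdiv : Tendsto (fun t => g t / c) atTop (𝓝 0) := by simpa using hg.div_const c
  have hsq : Tendsto (fun t => f t ^ 2) atTop (𝓝 0) :=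
    squeeze_zero (fun t => sq_nonneg _)
      (fun t => (le_div_iff₀ hc).2 (by linarith [h t])) hdiv
  simpa [Real.sqrt_sq (hf _)] using hsq.sqrt

/-- square-summability of PAO iterate gaps, and the gaps tend to 0. -/
theorem stmt_5 {d q n : ℕ}
    (Y : Matrix (Fin d) (Fin n) ℝ) (P : Matrix (Fin d) (Fin q) ℝ)
    (α β lam μ : ℝ) (hα : 0 < α) (hβ : 0 < β) (hlam : 0 < lam) (hμ : 0 < μ)
    (𝒜 : Set (Matrix (Fin d) (Fin q) ℝ)) (h𝒜ne : 𝒜.Nonempty)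
    (A : ℕ → Matrix (Fin d) (Fin q) ℝ) (X : ℕ → Matrix (Fin q) (Fin n) ℝ)
    (hA : ∀ t, A t ∈ 𝒜) (hX : ∀ t, X t ∈ simplexSet q n)
    (hminA : ∀ t, ∀ A' ∈ 𝒜,
      Lobj Y P α β (A (t + 1)) (X t) + (lam / 2) * (frob (A (t + 1) - A t)) ^ 2 ≤
        Lobj Y P α β A' (X t) + (lam / 2) * (frob (A' - A t)) ^ 2)
    (hminX : ∀ t, ∀ X' ∈ simplexSet q n,
      Lobj Y P α β (A (t + 1)) (X (t + 1)) + (μ / 2) * (frob (X (t + 1) - X t)) ^ 2 ≤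
        Lobj Y P α β (A (t + 1)) X' + (μ / 2) * (frob (X' - X t)) ^ 2) :
    (∑' t : ℕ, ((lam / 2) * (frob (A (t + 1) - A t)) ^ 2
        + (μ / 2) * (frob (X (t + 1) - X t)) ^ 2)) ≤ Lobj Y P α β (A 0) (X 0) ∧
    Tendsto (fun t => frob (A (t + 1) - A t)) atTop (𝓝 0) ∧
    Tendsto (fun t => frob (X (t + 1) - X t)) atTop (𝓝 0) := by
  set g : ℕ → ℝ := fun t => (lam / 2) * (frob (A (t + 1) - A t)) ^ 2
    + (μ / 2) * (frob (X (t + 1) - X t)) ^ 2 with hg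
  have g_nonneg : ∀ t, 0 ≤ g t := fun t => by positivity
  have decrease : ∀ t, Lobj Y P α β (A (t + 1)) (X (t + 1)) + g t ≤ Lobj Y P α β (A t) (X t) := by
    intro t
    have h₁ := hminA t (A t) (hA t)
    have h₂ := hminX t (X t) (hX t)
    simp only [sub_self, frob_zero] at h₁ h₂
    simp only [hg]
    linarith
  have bound := sum_range_le_of_sufficient_decrease
    (F := fun t => Lobj Y P α β (A t) (X t))
    (fun t => Lobj_nonneg Y P hα.le hβ.le (A t) (X t)) decrease
  have g_tendsto := (summable_of_sum_range_le g_nonneg bound).tendsto_atTop_zero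
  refine ⟨Real.tsum_le_of_sum_range_le g_nonneg bound,
    tendsto_zero_of_mul_sq_le (half_pos hlam) (fun t => frob_nonneg _) g_tendsto fun t => ?_,
    tendsto_zero_of_mul_sq_le (half_pos hμ) (fun t => frob_nonneg _) g_tendsto fun t => ?_⟩
  · exact le_add_of_nonneg_right (by positivity)
  · exact le_add_of_nonneg_left (by positivity)
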